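/- arXiv:1901.01917 — 2 statements merged into one kernel-verified Lean document; each statement's English description precedes it below -/
import Mathlib

section
/- Let B = [0,1]² and let ℙ be the orthonightrider, the piece with basic moves (2,1) and (1,−2). Then the denominator D(B^q, A_ℙ^q) of the inside-out polytope equals 1 if q = 1, equals 2 if q = 2, equals 20 if q = 3, and equals 15·2^{q−1} if q ≥ 4. -/
/-! Common definitions: boards, pieces, hyperplane arrangements, rank,
antipode maps, trajectories, augmentations, crossing points, denominators. -/

noncomputable section

/-- A point of the plane. -/
abbrev Pt : Type := ℝ × ℝ

/-- Dot product on `ℝ²`. -/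
def dotp (u v : Pt) : ℝ := u.1 * v.1 + u.2 * v.2

/-- A board: a rational convex polygon `{z | ∀ j, a_j · z ≤ β_j}`, bounded, with
nonempty interior, each defining line meeting the board in at least two points (an edge). -/
structure Board where
  s : ℕ
  A : Fin s → Pt
  β : Fin s → ℝ
  A_rat : ∀ j, ∃ p q : ℚ, A j = ((p : ℝ), (q : ℝ))
  β_rat : ∀ j, ∃ p : ℚ, β j = (p : ℝ)
  bounded : Bornology.IsBounded {z : Pt | ∀ j, dotp (A j) z ≤ β j}
  int_ne : (interior {z : Pt | ∀ j, dotp (A j) z ≤ β j}).Nonempty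
  edges : ∀ j, ∃ u v : Pt, u ≠ v ∧ (∀ k, dotp (A k) u ≤ β k) ∧ (∀ k, dotp (A k) v ≤ β k) ∧
    dotp (A j) u = β j ∧ dotp (A j) v = β j

/-- The set of points of the board. -/
def Board.set (Bd : Board) : Set Pt := {z | ∀ j, dotp (Bd.A j) z ≤ Bd.β j}

/-- The corners of the board: its extreme points. -/
def Board.corners (Bd : Board) : Set Pt := Set.extremePoints ℝ Bd.set

/-- A two-move rider: two nonparallel basic moves `(c r, d r)`, each with coprime entries. -/
structure Piece where
  c : Bool → ℤ
  d : Bool → ℤ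
  coprime : ∀ r, Int.gcd (c r) (d r) = 1
  nonparallel : c false * d true - c true * d false ≠ 0

/-- The basic move vector of `P` of type `r`, as a vector in `ℝ²`. -/
def Piece.mv (P : Piece) (r : Bool) : Pt := ((P.c r : ℝ), (P.d r : ℝ))

/-- The normal vector `(d_r, -c_r)` of the attack equations of type `r`. -/
def Piece.anorm (P : Piece) (r : Bool) : Pt := ((P.d r : ℝ), -(P.c r : ℝ))

/-- A configuration of `q` points in the plane; the configuration space is `ℝ^{2q}`. -/
abbrev Conf (q : ℕ) : Type := Fin q → Pt

/-- Dot product on the configuration space `ℝ^{2q}`. -/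
def confDot {q : ℕ} (u w : Conf q) : ℝ := ∑ k, dotp (u k) (w k)

/-- The vector of `ℝ^{2q}` whose `i`-th planar component is `v` and all others `0`. -/
def unitVec {q : ℕ} (i : Fin q) (v : Pt) : Conf q := fun k => if k = i then v else 0

/-- The normal vector in `ℝ^{2q}` of the attack hyperplane `(w_i - w_j) · v = 0`. -/
def attackNormal {q : ℕ} (i j : Fin q) (v : Pt) : Conf q :=
  fun k => if k = i then v else if k = j then -v else 0

/-- The hyperplane arrangement `H(z)` associated to a configuration `z`: each hyperplane
`{w | n · w = β}` is recorded as the pair `(n, β)`.  It consists of the attack hyperplanes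
through `z` and the fixation hyperplanes through `z`. -/
def HArr (Bd : Board) (P : Piece) {q : ℕ} (z : Conf q) : Set (Conf q × ℝ) :=
  {h | (∃ i j : Fin q, ∃ r : Bool, i < j ∧ dotp (z i - z j) (P.anorm r) = 0 ∧
          h = (attackNormal i j (P.anorm r), 0)) ∨
       (∃ i : Fin q, ∃ e : Fin Bd.s, dotp (Bd.A e) (z i) = Bd.β e ∧
          h = (unitVec i (Bd.A e), Bd.β e))}

/-- The rank of a configuration `z`: the dimension of the span of the normal vectors
of the hyperplanes of `H(z)`. -/
def confRank (Bd : Board) (P : Piece) {q : ℕ} (z : Conf q) : ℕ :=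
  Module.finrank ℝ (Submodule.span ℝ (Prod.fst '' HArr Bd P z))

/-- A configuration has full rank when its rank is `2q`. -/
def FullRank (Bd : Board) (P : Piece) {q : ℕ} (z : Conf q) : Prop :=
  confRank Bd P z = 2 * q

/-- `z ∈ B^q`. -/
def InBoard (Bd : Board) {q : ℕ} (z : Conf q) : Prop := ∀ i, z i ∈ Bd.set

/-- A vertex of the inside-out polytope `(B^q, A_P^q)`: a point of `B^q` that is the unique
common point of some subset of its associated hyperplane arrangement. -/
def IsVertex (Bd : Board) (P : Piece) {q : ℕ} (z : Conf q) : Prop :=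
  InBoard Bd z ∧
    ∃ H' ⊆ HArr Bd P z, {w : Conf q | ∀ h ∈ H', confDot h.1 w = h.2} = {z}

/-- The line through `b` in direction `v` meets the interior of `R`. -/
def meetsInterior (R : Set Pt) (v : Pt) (b : Pt) : Prop := ∃ t : ℝ, b + t • v ∈ interior R

/-- `b'` is the antipode of `b` in direction `v`: if the line through `b` with direction `v`
misses the interior of `R` then `b' = b`; otherwise `b'` is the second intersection point of
the line with the boundary of `R`. -/
def AntipRel (R : Set Pt) (v : Pt) (b b' : Pt) : Prop :=
  (¬ meetsInterior R v b → b' = b) ∧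
  (meetsInterior R v b → b' ∈ frontier R ∧ b' ≠ b ∧ ∃ t : ℝ, b' = b + t • v)

/-- `s` is the antipode map of `R` in direction `v`. -/
def IsAntipodeMap (R : Set Pt) (v : Pt) (s : Pt → Pt) : Prop :=
  ∀ b ∈ frontier R, AntipRel R v b (s b)

/-- The move type used at step `i` of an alternating sequence whose step `0` uses type `st`. -/
def altMove (st : Bool) (i : ℕ) : Bool := if i % 2 = 0 then st else !st

/-- A trajectory: a finite sequence `b 0, …, b (l-1)` of distinct boundary points of `R`,
each obtained from the previous by an antipode map, the move types alternating. -/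
def IsTrajectory (R : Set Pt) (mv : Bool → Pt) (l : ℕ) (b : ℕ → Pt) (st : Bool) : Prop :=
  1 ≤ l ∧ (∀ i, i < l → b i ∈ frontier R) ∧
  (∀ i j, i < l → j < l → b i = b j → i = j) ∧
  (∀ i, i + 1 < l → AntipRel R (mv (altMove st i)) (b i) (b (i + 1)))

/-- A cyclical trajectory: additionally the first point is the antipode of the last,
the move type continuing the alternation. -/
def IsCyclical (R : Set Pt) (mv : Bool → Pt) (l : ℕ) (b : ℕ → Pt) (st : Bool) : Prop :=
  IsTrajectory R mv l b st ∧ AntipRel R (mv (altMove st (l - 1))) (b (l - 1)) (b 0)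

/-- The configuration `(b 1, …, b l) ∈ B^l` formed by the points of a trajectory. -/
def trajConf (l : ℕ) (b : ℕ → Pt) : Conf l := fun i => b i

/-- A corner trajectory: a trajectory containing a corner of the board. -/
def IsCornerTraj (Bd : Board) (P : Piece) (l : ℕ) (b : ℕ → Pt) (st : Bool) : Prop :=
  IsTrajectory Bd.set P.mv l b st ∧ ∃ i, i < l ∧ b i ∈ Bd.corners

/-- A rigid cycle: a cyclical trajectory of full rank. -/
def IsRigidCycle (Bd : Board) (P : Piece) (l : ℕ) (b : ℕ → Pt) (st : Bool) : Prop :=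
  IsCyclical Bd.set P.mv l b st ∧ confRank Bd P (trajConf l b) = 2 * l

/-- The trajectory can be extended backwards (the relevant antipode of its first point
is a different point). -/
def CanExtendBack (R : Set Pt) (mv : Bool → Pt) (b : ℕ → Pt) (st : Bool) : Prop :=
  meetsInterior R (mv (altMove st 1)) (b 0)

/-- The trajectory can be extended forwards (the relevant antipode of its last point
is a different point). -/
def CanExtendFwd (R : Set Pt) (mv : Bool → Pt) (l : ℕ) (b : ℕ → Pt) (st : Bool) : Prop :=
  meetsInterior R (mv (altMove st (l - 1))) (b (l - 1))

/-- `a 0, …, a (L-1)` is the augmentation of the trajectory `b 0, …, b (l-1)`: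
the trajectory with the antipode of its first point prepended whenever it differs from the
first point, and the antipode of its last point appended whenever it differs from the
last point. -/
def IsAugmentation (R : Set Pt) (mv : Bool → Pt) (l : ℕ) (b : ℕ → Pt) (st : Bool)
    (L : ℕ) (a : ℕ → Pt) : Prop :=
  ∃ off : ℕ,
    (∀ i, i < l → a (i + off) = b i) ∧
    (CanExtendBack R mv b st → off = 1 ∧ AntipRel R (mv (altMove st 1)) (b 0) (a 0)) ∧
    (¬ CanExtendBack R mv b st → off = 0) ∧
    (CanExtendFwd R mv l b st →
      L = l + off + 1 ∧ AntipRel R (mv (altMove st (l - 1))) (b (l - 1)) (a (l + off))) ∧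
    (¬ CanExtendFwd R mv l b st → L = l + off)

/-- `c` is a crossing point of the two sequences: an interior point of `R` lying on a
segment of each. -/
def CrossingOfSeqs (R : Set Pt) (La : ℕ) (a : ℕ → Pt) (Lb : ℕ) (bb : ℕ → Pt) (c : Pt) : Prop :=
  c ∈ interior R ∧ ∃ i j, i + 1 < La ∧ j + 1 < Lb ∧
    c ∈ segment ℝ (a i) (a (i + 1)) ∧ c ∈ segment ℝ (bb j) (bb (j + 1))

/-- `c` is a self-crossing point of the sequence: an interior point of `R` lying on two
distinct segments of the sequence. -/
def SelfCrossingOfSeq (R : Set Pt) (La : ℕ) (a : ℕ → Pt) (c : Pt) : Prop :=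
  c ∈ interior R ∧ ∃ i j, i ≠ j ∧ i + 1 < La ∧ j + 1 < La ∧
    c ∈ segment ℝ (a i) (a (i + 1)) ∧ c ∈ segment ℝ (a j) (a (j + 1))

/-- `x` is a rational number whose denominator (in lowest terms) divides `D`. -/
def DenDvd (x : ℝ) (D : ℕ) : Prop := ∃ p : ℚ, (p : ℝ) = x ∧ p.den ∣ D

/-- Both coordinates of `z` are rational with denominators dividing `D`. -/
def PtDenDvd (z : Pt) (D : ℕ) : Prop := DenDvd z.1 D ∧ DenDvd z.2 D

/-- `D` is the denominator of the inside-out polytope `(B^q, A_P^q)`: the least common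
multiple of the denominators of the coordinates of all of its vertices. -/
def IsIOPDenom (Bd : Board) (P : Piece) (q : ℕ) (D : ℕ) : Prop :=
  (∀ z : Conf q, IsVertex Bd P z → ∀ i, PtDenDvd (z i) D) ∧
  (∀ D' : ℕ, (∀ z : Conf q, IsVertex Bd P z → ∀ i, PtDenDvd (z i) D') → D ∣ D')

/-- A finite family of finite sequences of points (with starting move types),
to be used as a family of trajectories. -/
structure TrajFamily where
  m : ℕ
  len : ℕ → ℕ
  pts : ℕ → ℕ → Pt
  st : ℕ → Bool

/-- Every member of the family is a trajectory. -/
def TrajFamily.Wf (F : TrajFamily) (R : Set Pt) (mv : Bool → Pt) : Prop :=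
  ∀ k, k < F.m → IsTrajectory R mv (F.len k) (F.pts k) (F.st k)

/-- The members of the family partition the set `S`: their point sets are pairwise disjoint
with union `S`. -/
def TrajFamily.Partitions (F : TrajFamily) (S : Set Pt) : Prop :=
  {p | ∃ k, k < F.m ∧ ∃ i, i < F.len k ∧ F.pts k i = p} = S ∧
  ∀ k k', k < F.m → k' < F.m → k ≠ k' →
    ∀ i i', i < F.len k → i' < F.len k' → F.pts k i ≠ F.pts k' i'

/-- The family is a partition into maximal trajectories: no point of one member is an
antipode of a point of a different member (no edge of the antipode graph joins two
distinct members). -/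
def TrajFamily.Maximal (F : TrajFamily) (R : Set Pt) (mv : Bool → Pt) : Prop :=
  ∀ k k', k < F.m → k' < F.m → k ≠ k' →
    ∀ i i', i < F.len k → i' < F.len k' →
      ∀ r : Bool, ¬ AntipRel R (mv r) (F.pts k i) (F.pts k' i')

/-- The unit square `[0,1]²`. -/
def unitSq : Set Pt := Set.Icc ((0, 0) : Pt) ((1, 1) : Pt)

end

noncomputable section

/-- The parameter of the line through `p` in the direction `(2, 1)`. -/
def uval (p : Pt) : ℝ := p.1 - 2 * p.2

/-- The parameter of the line through `p` in the direction `(1, -2)`. -/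
def vval (p : Pt) : ℝ := 2 * p.1 + p.2

/-- `p` lies on one of the vertical lines `x = 0`, `x = 1`. -/
def OnX (p : Pt) : Prop := p.1 = 0 ∨ p.1 = 1

/-- `p` lies on one of the horizontal lines `y = 0`, `y = 1`. -/
def OnY (p : Pt) : Prop := p.2 = 0 ∨ p.2 = 1

theorem eq_of_uval_eq_of_vval_eq {p p' : Pt} (hu : uval p = uval p') (hv : vval p = vval p') :
    p = p' := by
  unfold uval at hu
  unfold vval at hv
  ext <;> linarith

/-! ### The edges of a board equal to the unit square -/

theorem mem_unitSq {p : Pt} : p ∈ unitSq ↔ (0 ≤ p.1 ∧ p.1 ≤ 1) ∧ (0 ≤ p.2 ∧ p.2 ≤ 1) := by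
  simp only [unitSq, Set.mem_Icc, Prod.le_def]
  tauto

theorem Board.edge_cases {Bd : Board} (hBd : Bd.set = unitSq) (e : Fin Bd.s) :
    ∃ l : ℝ, (Bd.A e = (l, 0) ∧ (Bd.β e = 0 ∧ l ≤ 0 ∨ Bd.β e = l ∧ 0 ≤ l)) ∨
      (Bd.A e = (0, l) ∧ (Bd.β e = 0 ∧ l ≤ 0 ∨ Bd.β e = l ∧ 0 ≤ l)) := by
  have key : ∀ p : Pt, p ∈ unitSq → dotp (Bd.A e) p ≤ Bd.β e := fun p hp => by
    rw [← hBd] at hp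
    exact hp e
  obtain ⟨p, p', hne, hp, hp', hpe, hpe'⟩ := Bd.edges e
  have hp : p ∈ unitSq := hBd ▸ hp
  have hp' : p' ∈ unitSq := hBd ▸ hp'
  rw [mem_unitSq] at hp hp'
  have k00 := key (0, 0) (by simp [mem_unitSq])
  have k10 := key (1, 0) (by simp [mem_unitSq])
  have k01 := key (0, 1) (by simp [mem_unitSq])
  have k11 := key (1, 1) (by simp [mem_unitSq])
  generalize Bd.A e = a at *
  generalize Bd.β e = b at *
  obtain ⟨a₁, a₂⟩ := a
  obtain ⟨x, y⟩ := p
  obtain ⟨x', y'⟩ := p'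
  obtain ⟨⟨hx0, hx1⟩, hy0, hy1⟩ := hp
  obtain ⟨⟨hx0', hx1'⟩, hy0', hy1'⟩ := hp'
  simp only [dotp, mul_zero, mul_one, add_zero, zero_add] at *
  have unique : ∀ s t : ℝ, a₁ ≠ 0 → a₂ ≠ 0 → a₁ * (x - s) + a₂ * (y - t) = 0 →
      a₁ * (x' - s) + a₂ * (y' - t) = 0 → a₁ * (x - s) ≤ 0 → a₁ * (x' - s) ≤ 0 →
      a₂ * (y - t) ≤ 0 → a₂ * (y' - t) ≤ 0 → False := by
    intro s t h₁ h₂ e e' i₁ i₂ i₃ i₄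
    have j₁ : a₁ * (x - s) = 0 := by linarith
    have j₂ : a₁ * (x' - s) = 0 := by linarith
    have j₃ : a₂ * (y - t) = 0 := by linarith
    have j₄ : a₂ * (y' - t) = 0 := by linarith
    simp only [mul_eq_zero, h₁, h₂, false_or] at j₁ j₂ j₃ j₄
    exact hne (Prod.ext (by simp only; linarith) (by simp only; linarith))
  rcases lt_trichotomy a₁ 0 with h₁ | h₁ | h₁ <;> rcases lt_trichotomy a₂ 0 with h₂ | h₂ | h₂
  · exact (unique 0 0 h₁.ne h₂.ne (by nlinarith) (by nlinarith) (by nlinarith) (by nlinarith)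
      (by nlinarith) (by nlinarith)).elim
  · exact ⟨a₁, Or.inl ⟨by rw [h₂], Or.inl ⟨by subst h₂; nlinarith, h₁.le⟩⟩⟩
  · exact (unique 0 1 h₁.ne h₂.ne' (by nlinarith) (by nlinarith) (by nlinarith) (by nlinarith)
      (by nlinarith) (by nlinarith)).elim
  · exact ⟨a₂, Or.inr ⟨by rw [h₁], Or.inl ⟨by subst h₁; nlinarith, h₂.le⟩⟩⟩
  · exact ⟨0, Or.inl ⟨by rw [h₁, h₂], Or.inl ⟨by subst h₁ h₂; linarith, le_rfl⟩⟩⟩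
  · exact ⟨a₂, Or.inr ⟨by rw [h₁], Or.inr ⟨by subst h₁; nlinarith, h₂.le⟩⟩⟩
  · exact (unique 1 0 h₁.ne' h₂.ne (by nlinarith) (by nlinarith) (by nlinarith) (by nlinarith)
      (by nlinarith) (by nlinarith)).elim
  · exact ⟨a₁, Or.inl ⟨by rw [h₂], Or.inr ⟨by subst h₂; nlinarith, h₁.le⟩⟩⟩
  · exact (unique 1 1 h₁.ne' h₂.ne' (by nlinarith) (by nlinarith) (by nlinarith) (by nlinarith)
      (by nlinarith) (by nlinarith)).elim

theorem Board.exists_edge_x_eq_zero {Bd : Board} (hBd : Bd.set = unitSq) :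
    ∃ e, ∃ l : ℝ, l ≠ 0 ∧ Bd.A e = (l, 0) ∧ Bd.β e = 0 := by
  by_contra! h
  have hmem : ((-1, 1 / 2) : Pt) ∈ Bd.set := fun e => by
    obtain ⟨l, ⟨ha, hb⟩ | ⟨ha, hb⟩⟩ := Board.edge_cases hBd e
    · have h' := fun hl => h e l hl ha
      rcases eq_or_ne l 0 with hl | hl
      · subst hl
        rcases hb with ⟨hb, -⟩ | ⟨hb, -⟩ <;> simp [ha, hb, dotp]
      · rcases hb with ⟨hb, -⟩ | ⟨hb, hl'⟩
        · exact (h' hl hb).elim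
        · simp only [ha, hb, dotp]; linarith
    · rcases hb with ⟨hb, hl'⟩ | ⟨hb, hl'⟩ <;> simp only [ha, hb, dotp] <;> linarith
  rw [hBd, mem_unitSq] at hmem
  norm_num at hmem

theorem Board.exists_edge_x_eq_one {Bd : Board} (hBd : Bd.set = unitSq) :
    ∃ e, ∃ l : ℝ, l ≠ 0 ∧ Bd.A e = (l, 0) ∧ Bd.β e = l := by
  by_contra! h
  have hmem : ((2, 1 / 2) : Pt) ∈ Bd.set := fun e => by
    obtain ⟨l, ⟨ha, hb⟩ | ⟨ha, hb⟩⟩ := Board.edge_cases hBd e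
    · have h' := fun hl => h e l hl ha
      rcases eq_or_ne l 0 with hl | hl
      · subst hl
        rcases hb with ⟨hb, -⟩ | ⟨hb, -⟩ <;> simp [ha, hb, dotp]
      · rcases hb with ⟨hb, hl'⟩ | ⟨hb, -⟩
        · simp only [ha, hb, dotp]; linarith
        · exact (h' hl hb).elim
    · rcases hb with ⟨hb, hl'⟩ | ⟨hb, hl'⟩ <;> simp only [ha, hb, dotp] <;> linarith
  rw [hBd, mem_unitSq] at hmem
  norm_num at hmem

theorem Board.exists_edge_y_eq_zero {Bd : Board} (hBd : Bd.set = unitSq) :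
    ∃ e, ∃ l : ℝ, l ≠ 0 ∧ Bd.A e = (0, l) ∧ Bd.β e = 0 := by
  by_contra! h
  have hmem : ((1 / 2, -1) : Pt) ∈ Bd.set := fun e => by
    obtain ⟨l, ⟨ha, hb⟩ | ⟨ha, hb⟩⟩ := Board.edge_cases hBd e
    · rcases hb with ⟨hb, hl'⟩ | ⟨hb, hl'⟩ <;> simp only [ha, hb, dotp] <;> linarith
    · have h' := fun hl => h e l hl ha
      rcases eq_or_ne l 0 with hl | hl
      · subst hl
        rcases hb with ⟨hb, -⟩ | ⟨hb, -⟩ <;> simp [ha, hb, dotp]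
      · rcases hb with ⟨hb, -⟩ | ⟨hb, hl'⟩
        · exact (h' hl hb).elim
        · simp only [ha, hb, dotp]; linarith
  rw [hBd, mem_unitSq] at hmem
  norm_num at hmem

theorem Board.exists_edge_y_eq_one {Bd : Board} (hBd : Bd.set = unitSq) :
    ∃ e, ∃ l : ℝ, l ≠ 0 ∧ Bd.A e = (0, l) ∧ Bd.β e = l := by
  by_contra! h
  have hmem : ((1 / 2, 2) : Pt) ∈ Bd.set := fun e => by
    obtain ⟨l, ⟨ha, hb⟩ | ⟨ha, hb⟩⟩ := Board.edge_cases hBd e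
    · rcases hb with ⟨hb, hl'⟩ | ⟨hb, hl'⟩ <;> simp only [ha, hb, dotp] <;> linarith
    · have h' := fun hl => h e l hl ha
      rcases eq_or_ne l 0 with hl | hl
      · subst hl
        rcases hb with ⟨hb, -⟩ | ⟨hb, -⟩ <;> simp [ha, hb, dotp]
      · rcases hb with ⟨hb, hl'⟩ | ⟨hb, -⟩
        · simp only [ha, hb, dotp]; linarith
        · exact (h' hl hb).elim
  rw [hBd, mem_unitSq] at hmem
  norm_num at hmem

/-! ### Vertices of the inside-out polytope -/

theorem confDot_unitVec {q : ℕ} (i : Fin q) (v : Pt) (w : Conf q) :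
    confDot (unitVec i v) w = dotp v (w i) := by
  unfold confDot unitVec
  rw [Finset.sum_eq_single i]
  · simp
  · intro b _ hb
    simp [hb, dotp]
  · simp

theorem confDot_attackNormal {q : ℕ} {i j : Fin q} (hij : i ≠ j) (v : Pt) (w : Conf q) :
    confDot (attackNormal i j v) w = dotp (w i - w j) v := by
  unfold confDot attackNormal
  rw [Finset.sum_eq_add i j hij]
  · simp only [if_true, if_neg hij.symm, dotp, Prod.fst_sub, Prod.snd_sub, Prod.fst_neg,
      Prod.snd_neg]
    ring
  · intro c _ hc
    simp [hc.1, hc.2, dotp]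
  · simp
  · simp

/-- The moves of the orthonightrider. -/
structure Piece.IsOrthonightrider (P : Piece) : Prop where
  c_false : P.c false = 2
  d_false : P.d false = 1
  c_true : P.c true = 1
  d_true : P.d true = -2

theorem Piece.IsOrthonightrider.dotp_false {P : Piece} (hP : P.IsOrthonightrider) (p p' : Pt) :
    dotp (p - p') (P.anorm false) = uval p - uval p' := by
  simp only [dotp, Piece.anorm, hP.c_false, hP.d_false, uval, Prod.fst_sub, Prod.snd_sub]
  push_cast
  ring

theorem Piece.IsOrthonightrider.dotp_true {P : Piece} (hP : P.IsOrthonightrider) (p p' : Pt) :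
    dotp (p - p') (P.anorm true) = vval p' - vval p := by
  simp only [dotp, Piece.anorm, hP.c_true, hP.d_true, vval, Prod.fst_sub, Prod.snd_sub]
  push_cast
  ring

/-- Infinitesimal deformations of the lines through the pieces of a vertex that preserve the
fixations are trivial. -/
theorem IsVertex.deformation_eq_zero {Bd : Board} (hBd : Bd.set = unitSq) {P : Piece}
    (hP : P.IsOrthonightrider) {q : ℕ} {z : Conf q} (hz : IsVertex Bd P z) (α β : ℝ → ℝ)
    (hx : ∀ j, OnX (z j) → α (uval (z j)) + 2 * β (vval (z j)) = 0)
    (hy : ∀ j, OnY (z j) → β (vval (z j)) = 2 * α (uval (z j))) (j : Fin q) :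
    α (uval (z j)) = 0 ∧ β (vval (z j)) = 0 := by
  obtain ⟨-, H, hH, huniq⟩ := hz
  set w : Conf q := fun j =>
    ((z j).1 + (α (uval (z j)) + 2 * β (vval (z j))) / 5,
      (z j).2 + (β (vval (z j)) - 2 * α (uval (z j))) / 5) with hw
  have hwu : ∀ j, uval (w j) = uval (z j) + α (uval (z j)) := fun j => by
    simp only [hw, uval]; ring
  have hwv : ∀ j, vval (w j) = vval (z j) + β (vval (z j)) := fun j => by
    simp only [hw, vval]; ring
  have hmem : w ∈ {w : Conf q | ∀ h ∈ H, confDot h.1 w = h.2} := by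
    intro h hh
    rcases hH hh with ⟨i, k, r, hik, h0, rfl⟩ | ⟨i, e, h0, rfl⟩
    · simp only [confDot_attackNormal hik.ne]
      cases r
      · rw [hP.dotp_false] at h0 ⊢
        rw [hwu, hwu, sub_eq_zero.1 h0, sub_self]
      · rw [hP.dotp_true] at h0 ⊢
        rw [hwv, hwv, sub_eq_zero.1 h0, sub_self]
    · simp only [confDot_unitVec]
      obtain ⟨l, ⟨ha, hb⟩ | ⟨ha, hb⟩⟩ := Board.edge_cases hBd e
      · rcases eq_or_ne l 0 with hl | hl
        · rw [← h0, ha, hl]; simp [dotp]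
        · have : OnX (z i) := by
            rw [ha] at h0
            simp only [dotp, zero_mul, add_zero] at h0
            rcases hb with ⟨hb, -⟩ | ⟨hb, -⟩
            · left; simpa [hb, hl] using h0
            · right; simpa [hb, hl] using h0
          rw [← h0, ha]
          simp only [hw, dotp, hx i this]
          ring
      · rcases eq_or_ne l 0 with hl | hl
        · rw [← h0, ha, hl]; simp [dotp]
        · have : OnY (z i) := by
            rw [ha] at h0
            simp only [dotp, zero_mul, zero_add] at h0
            rcases hb with ⟨hb, -⟩ | ⟨hb, -⟩
            · left; simpa [hb, hl] using h0
            · right; simpa [hb, hl] using h0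
          rw [← h0, ha]
          simp only [hw, dotp, hy i this]
          ring
  rw [huniq] at hmem
  have hwz : w j = z j := congrFun hmem j
  have h₁ := hwu j
  have h₂ := hwv j
  rw [hwz] at h₁ h₂
  constructor <;> linarith

theorem isVertex_of_unique {Bd : Board} (hBd : Bd.set = unitSq) {P : Piece}
    (hP : P.IsOrthonightrider) {q : ℕ} {z : Conf q} (hz : ∀ i, z i ∈ unitSq)
    (huniq : ∀ w : Conf q, (∀ i j, uval (z i) = uval (z j) → uval (w i) = uval (w j)) →
      (∀ i j, vval (z i) = vval (z j) → vval (w i) = vval (w j)) →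
      (∀ i, OnX (z i) → (w i).1 = (z i).1) → (∀ i, OnY (z i) → (w i).2 = (z i).2) → w = z) :
    IsVertex Bd P z := by
  refine ⟨fun i => hBd ▸ hz i, HArr Bd P z, subset_rfl, ?_⟩
  ext w
  simp only [Set.mem_ofPred_eq, Set.mem_singleton_iff]
  constructor
  · intro hw
    have attack : ∀ i j r, i < j → dotp (z i - z j) (P.anorm r) = 0 →
        dotp (w i - w j) (P.anorm r) = 0 := fun i j r hij h0 => by
      have := hw _ (Or.inl ⟨i, j, r, hij, h0, rfl⟩)
      rwa [confDot_attackNormal hij.ne] at this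
    have fix : ∀ i e, dotp (Bd.A e) (z i) = Bd.β e → dotp (Bd.A e) (w i) = Bd.β e :=
      fun i e h0 => by
        have := hw _ (Or.inr ⟨i, e, h0, rfl⟩)
        rwa [confDot_unitVec] at this
    apply huniq
    · intro i j h
      rcases lt_trichotomy i j with hij | rfl | hij
      · have := attack i j false hij (by rw [hP.dotp_false, h, sub_self])
        rw [hP.dotp_false] at this
        linarith
      · rfl
      · have := attack j i false hij (by rw [hP.dotp_false, h, sub_self])
        rw [hP.dotp_false] at this
        linarith
    · intro i j h
      rcases lt_trichotomy i j with hij | rfl | hij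
      · have := attack i j true hij (by rw [hP.dotp_true, h, sub_self])
        rw [hP.dotp_true] at this
        linarith
      · rfl
      · have := attack j i true hij (by rw [hP.dotp_true, h, sub_self])
        rw [hP.dotp_true] at this
        linarith
    · rintro i (h | h)
      · obtain ⟨e, l, hl, ha, hb⟩ := Board.exists_edge_x_eq_zero hBd
        have := fix i e (by simp [ha, hb, dotp, h])
        simpa [ha, hb, dotp, hl, h] using this
      · obtain ⟨e, l, hl, ha, hb⟩ := Board.exists_edge_x_eq_one hBd
        have := fix i e (by simp [ha, hb, dotp, h])
        simpa [ha, hb, dotp, hl, h] using this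
    · rintro i (h | h)
      · obtain ⟨e, l, hl, ha, hb⟩ := Board.exists_edge_y_eq_zero hBd
        have := fix i e (by simp [ha, hb, dotp, h])
        simpa [ha, hb, dotp, hl, h] using this
      · obtain ⟨e, l, hl, ha, hb⟩ := Board.exists_edge_y_eq_one hBd
        have := fix i e (by simp [ha, hb, dotp, h])
        simpa [ha, hb, dotp, hl, h] using this
  · rintro rfl h (⟨i, j, r, hij, h0, rfl⟩ | ⟨i, e, h0, rfl⟩)
    · simpa only [confDot_attackNormal hij.ne] using h0
    · simpa only [confDot_unitVec] using h0

/-! ### The expanding map on lines -/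

/-- Solutions of `F l = c l * F (E l)` off `M` vanishing only where the orbit avoids `M`. -/
theorem exists_eq_mul_comp {L : Type*} (E : L → L) (c : L → ℝ) (hc : ∀ l, c l ≠ 0)
    (M : L → Prop) :
    ∃ F : L → ℝ, (∀ l, ¬ M l → F l = c l * F (E l)) ∧
      ∀ l, F l = 0 → ∀ n, ¬ M (E^[n] l) := by
  classical
  refine ⟨fun l => if h : ∃ n, M (E^[n] l) then
    ∏ k ∈ Finset.range (Nat.find h), c (E^[k] l) else 0, ?_, ?_⟩
  · intro l hl
    by_cases h : ∃ n, M (E^[n] l)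
    · have h' : ∃ n, M (E^[n + 1] l) := by
        obtain ⟨n, hn⟩ := h
        cases n with
        | zero => exact (hl hn).elim
        | succ n => exact ⟨n, hn⟩
      have hE : ∃ n, M (E^[n] (E l)) := h'
      have hfind : Nat.find h = Nat.find hE + 1 := Nat.find_comp_succ h h' hl
      simp only [dif_pos h, dif_pos hE]
      rw [hfind, Finset.prod_range_succ']
      simp only [Function.iterate_succ_apply, Function.iterate_zero, id_eq]
      ring
    · have hE : ¬ ∃ n, M (E^[n] (E l)) := fun ⟨n, hn⟩ => h ⟨n + 1, hn⟩
      simp only [dif_neg h, dif_neg hE, mul_zero]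
  · intro l hl n hn
    have h : ∃ n, M (E^[n] l) := ⟨n, hn⟩
    simp only [dif_pos h] at hl
    exact Finset.prod_ne_zero_iff.2 (fun k _ => hc _) hl

theorem eq_five_sixths_of_expanding {s : ℕ → ℝ} (hs : ∀ n, 1 / 2 < s n ∧ s n < 3 / 2)
    (hrec : ∀ n, s (n + 1) = |2 * s n - 5 / 2|) : s 0 = 5 / 6 := by
  have hstep : ∀ n, s (n + 1) - 5 / 6 = -2 * (s n - 5 / 6) := fun n => by
    have h₁ := hs n
    have h₂ := hs (n + 1)
    rw [hrec n] at h₂ ⊢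
    rcases abs_cases (2 * s n - 5 / 2) with ⟨h, -⟩ | ⟨h, -⟩ <;> rw [h] at h₂ ⊢ <;> linarith
  have hpow : ∀ n, |s n - 5 / 6| = 2 ^ n * |s 0 - 5 / 6| := fun n => by
    induction n with
    | zero => simp
    | succ n ih => rw [hstep, abs_mul, ih, pow_succ]; norm_num; ring
  by_contra hne
  have hpos : 0 < |s 0 - 5 / 6| := abs_pos.2 (sub_ne_zero.2 hne)
  obtain ⟨n, hn⟩ := pow_unbounded_of_one_lt (1 / |s 0 - 5 / 6|) (one_lt_two (α := ℝ))
  rw [div_lt_iff₀ hpos, ← hpow] at hn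
  have := hs n
  have : |s n - 5 / 6| ≤ 1 := abs_le.2 ⟨by linarith, by linarith⟩
  linarith

/-- The distance, suitably normalized, of a line in one of the two directions (left: `(2, 1)`,
right: `(1, -2)`) from the centre of the square. -/
def lineDist : ℝ ⊕ ℝ → ℝ := Sum.elim (fun u => |u + 1 / 2|) (fun v => |v - 3 / 2|)

/-- The map sending a line to the other line through one of its two boundary points. -/
def lineMap : ℝ ⊕ ℝ → ℝ ⊕ ℝ :=
  Sum.elim (fun u => Sum.inr (if -1 / 2 < u then 2 * u else 2 * u + 5))
    (fun v => Sum.inl (if v < 3 / 2 then -2 * v else 5 - 2 * v))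

theorem lineDist_lineMap (l : ℝ ⊕ ℝ) : lineDist (lineMap l) = |2 * lineDist l - 5 / 2| := by
  rcases l with u | v <;> simp only [lineDist, lineMap, Sum.elim_inl, Sum.elim_inr]
  · split_ifs with h
    · rw [abs_of_pos (show 0 < u + 1 / 2 by linarith)]; congr 1; ring
    · rw [abs_of_nonpos (show u + 1 / 2 ≤ 0 by linarith), ← abs_neg]; congr 1; ring
  · split_ifs with h
    · rw [abs_of_neg (show v - 3 / 2 < 0 by linarith)]; congr 1; ring
    · rw [abs_of_nonneg (show 0 ≤ v - 3 / 2 by linarith), ← abs_neg]; congr 1; ring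

/-- Deformations of the lines that preserve the boundary edges away from the corners. -/
theorem exists_deformation :
    ∃ α β : ℝ → ℝ,
      (∀ p : Pt, p ∈ unitSq → OnX p → ¬ OnY p → α (uval p) + 2 * β (vval p) = 0) ∧
      (∀ p : Pt, p ∈ unitSq → OnY p → ¬ OnX p → β (vval p) = 2 * α (uval p)) ∧
      (∀ u, α u = 0 → |u + 1 / 2| = 5 / 6) ∧ ∀ v, β v = 0 → |v - 3 / 2| = 5 / 6 := by
  obtain ⟨F, hF, hF0⟩ := exists_eq_mul_comp lineMap
    (Sum.elim (fun _ => 1 / 2) (fun _ => -1 / 2)) (by rintro (_ | _) <;> norm_num)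
    (fun l => ¬ (1 / 2 < lineDist l ∧ lineDist l < 3 / 2))
  simp only [not_not] at hF hF0
  have hzero : ∀ l, F l = 0 → lineDist l = 5 / 6 := fun l hl =>
    eq_five_sixths_of_expanding (s := fun n => lineDist (lineMap^[n] l)) (hF0 l hl)
      (fun n => by simp only [Function.iterate_succ_apply', lineDist_lineMap])
  refine ⟨fun u => F (Sum.inl u), fun v => F (Sum.inr v), ?_, ?_, fun u hu => hzero _ hu,
    fun v hv => hzero _ hv⟩
  · rintro ⟨x, y⟩ hp hx hy
    obtain ⟨-, h0, h1⟩ := mem_unitSq.1 hp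
    simp only [OnY, not_or] at hy h0 h1
    have h0 : 0 < y := lt_of_le_of_ne h0 (Ne.symm hy.1)
    have h1 : y < 1 := lt_of_le_of_ne h1 hy.2
    simp only [uval, vval]
    rcases hx with rfl | rfl
    · have := hF (Sum.inr (2 * 0 + y)) (by
        simp only [lineDist, Sum.elim_inr]
        rw [abs_of_neg (by linarith)]
        constructor <;> linarith)
      rw [this]
      simp only [lineMap, Sum.elim_inr]
      rw [if_pos (by linarith)]
      ring_nf
    · have := hF (Sum.inr (2 * 1 + y)) (by
        simp only [lineDist, Sum.elim_inr]
        rw [abs_of_pos (by linarith)]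
        constructor <;> linarith)
      rw [this]
      simp only [lineMap, Sum.elim_inr]
      rw [if_neg (by linarith)]
      ring_nf
  · rintro ⟨x, y⟩ hp hy hx
    obtain ⟨⟨h0, h1⟩, -⟩ := mem_unitSq.1 hp
    simp only [OnX, not_or] at hx h0 h1
    have h0 : 0 < x := lt_of_le_of_ne h0 (Ne.symm hx.1)
    have h1 : x < 1 := lt_of_le_of_ne h1 hx.2
    simp only [uval, vval]
    rcases hy with rfl | rfl
    · have := hF (Sum.inl (x - 2 * 0)) (by
        simp only [lineDist, Sum.elim_inl]
        rw [abs_of_pos (by linarith)]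
        constructor <;> linarith)
      rw [this]
      simp only [lineMap, Sum.elim_inl]
      rw [if_pos (by linarith)]
      ring_nf
    · have := hF (Sum.inl (x - 2 * 1)) (by
        simp only [lineDist, Sum.elim_inl]
        rw [abs_of_neg (by linarith)]
        constructor <;> linarith)
      rw [this]
      simp only [lineMap, Sum.elim_inl]
      rw [if_neg (by linarith)]
      ring_nf

/-! ### Denominators -/

/-- `D * x` is an integer. -/
def IntMul (D : ℕ) (x : ℝ) : Prop := ∃ n : ℤ, (D : ℝ) * x = n

theorem IntMul.mono {D D' : ℕ} (h : D ∣ D') {x : ℝ} (hx : IntMul D x) : IntMul D' x := by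
  obtain ⟨k, rfl⟩ := h
  obtain ⟨n, hn⟩ := hx
  exact ⟨k * n, by push_cast; rw [← hn]; ring⟩

theorem IntMul.denDvd {D : ℕ} (hD : D ≠ 0) {x : ℝ} (hx : IntMul D x) : DenDvd x D := by
  obtain ⟨n, hn⟩ := hx
  refine ⟨(n : ℚ) / (D : ℤ), ?_, by exact_mod_cast Rat.den_dvd n D⟩
  push_cast
  rw [← hn]
  field_simp

theorem DenDvd.intMul {D : ℕ} {x : ℝ} (hx : DenDvd x D) : IntMul D x := by
  obtain ⟨p, rfl, k, rfl⟩ := hx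
  refine ⟨p.num * k, ?_⟩
  have : (p.den : ℝ) * (p : ℝ) = p.num := by exact_mod_cast Rat.den_mul_eq_num p
  push_cast
  rw [← this]
  ring

theorem IntMul.dvd_of_coprime {D N a : ℕ} (h : Nat.Coprime N a) {x : ℝ}
    (hx : (N : ℝ) * x = a) (hD : IntMul D x) : N ∣ D := by
  obtain ⟨n, hn⟩ := hD
  have h₁ : (N : ℤ) * n = D * a := by
    have : (N : ℝ) * n = D * a := by rw [← hn, ← hx]; ring
    exact_mod_cast this
  have h₂ : (N : ℤ) ∣ D * a := ⟨n, h₁.symm⟩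
  exact h.dvd_of_dvd_mul_right (by exact_mod_cast h₂)

theorem IntMul.of_uval_vval {D : ℕ} {p : Pt} (hu : IntMul D (uval p)) (hv : IntMul D (vval p)) :
    IntMul (5 * D) p.1 ∧ IntMul (5 * D) p.2 := by
  obtain ⟨m, hm⟩ := hu
  obtain ⟨n, hn⟩ := hv
  unfold uval at hm
  unfold vval at hn
  refine ⟨⟨m + 2 * n, ?_⟩, ⟨n - 2 * m, ?_⟩⟩ <;> push_cast <;> linarith

theorem IntMul.uval_vval {D : ℕ} {p : Pt} (hp : IntMul D p.1 ∧ IntMul D p.2) :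
    IntMul D (uval p) ∧ IntMul D (vval p) := by
  obtain ⟨⟨m, hm⟩, n, hn⟩ := hp
  unfold uval vval
  refine ⟨⟨m - 2 * n, ?_⟩, ⟨2 * m + n, ?_⟩⟩ <;> push_cast <;> linarith

/-- Passing from a boundary point to another one along a line at most doubles the denominator. -/
theorem IntMul.two_mul_of_line_eq {D : ℕ} {p p' : Pt} (hp : IntMul D p.1 ∧ IntMul D p.2)
    (hp' : OnX p' ∨ OnY p') (h : uval p = uval p' ∨ vval p = vval p') :
    IntMul (2 * D) p'.1 ∧ IntMul (2 * D) p'.2 := by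
  obtain ⟨⟨a, ha⟩, b, hb⟩ := IntMul.uval_vval hp
  obtain ⟨x, y⟩ := p'
  have int : ∃ e : ℤ, x = e ∨ y = e := by
    rcases hp' with (h | h) | (h | h)
    · exact ⟨0, by left; simpa using h⟩
    · exact ⟨1, by left; simpa using h⟩
    · exact ⟨0, by right; simpa using h⟩
    · exact ⟨1, by right; simpa using h⟩
  obtain ⟨e, rfl | rfl⟩ := int
  · rcases h with h | h
    · rw [h] at ha
      simp only [uval] at ha
      exact ⟨⟨2 * D * e, by push_cast; ring⟩, D * e - a, by push_cast; linarith⟩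
    · rw [h] at hb
      simp only [vval] at hb
      exact ⟨⟨2 * D * e, by push_cast; ring⟩, 2 * b - 4 * D * e, by push_cast; linarith⟩
  · rcases h with h | h
    · rw [h] at ha
      simp only [uval] at ha
      exact ⟨⟨2 * a + 4 * D * e, by push_cast; linarith⟩, 2 * D * e, by push_cast; ring⟩
    · rw [h] at hb
      simp only [vval] at hb
      exact ⟨⟨b - D * e, by push_cast; linarith⟩, 2 * D * e, by push_cast; ring⟩

/-! ### Boundary pieces of a vertex -/

/-- The graph on the pieces of a configuration joining the boundary pieces on a common line. -/
def boundaryGraph {q : ℕ} (z : Conf q) : SimpleGraph (Fin q) where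
  Adj a b := a ≠ b ∧ (OnX (z a) ∨ OnY (z a)) ∧ (OnX (z b) ∨ OnY (z b)) ∧
    (uval (z a) = uval (z b) ∨ vval (z a) = vval (z b))
  symm := ⟨fun _ _ h => ⟨h.1.symm, h.2.2.1, h.2.1, h.2.2.2.imp Eq.symm Eq.symm⟩⟩
  loopless := ⟨fun _ h => h.1 rfl⟩

/-- The piece `i` is connected to a corner piece through boundary pieces. -/
def CornerReachable {q : ℕ} (z : Conf q) (i : Fin q) : Prop :=
  ∃ c, (OnX (z c) ∧ OnY (z c)) ∧ (boundaryGraph z).Reachable c i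

theorem CornerReachable.of_line_eq {q : ℕ} {z : Conf q} {i j : Fin q} (h : CornerReachable z i)
    (hi : OnX (z i) ∨ OnY (z i)) (hj : OnX (z j) ∨ OnY (z j))
    (hij : uval (z i) = uval (z j) ∨ vval (z i) = vval (z j)) : CornerReachable z j := by
  rcases eq_or_ne i j with rfl | hne
  · exact h
  · obtain ⟨c, hc, hr⟩ := h
    have hadj : (boundaryGraph z).Adj i j := ⟨hne, hi, hj, hij⟩
    exact ⟨c, hc, hr.trans hadj.reachable⟩

theorem intMul_of_walk {q : ℕ} {z : Conf q} {a b : Fin q} (w : (boundaryGraph z).Walk a b) :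
    ∀ {D : ℕ}, IntMul D (z a).1 ∧ IntMul D (z a).2 →
      IntMul (2 ^ w.length * D) (z b).1 ∧ IntMul (2 ^ w.length * D) (z b).2 := by
  induction w with
  | nil => intro D h; simpa using h
  | cons h w ih =>
    intro D hD
    have := ih (IntMul.two_mul_of_line_eq hD h.2.2.1 h.2.2.2)
    rwa [← mul_assoc, ← pow_succ] at this

theorem boundary_of_mem_support {q : ℕ} {z : Conf q} {a b : Fin q}
    (w : (boundaryGraph z).Walk a b) (ha : OnX (z a) ∨ OnY (z a)) :
    ∀ c ∈ w.support, OnX (z c) ∨ OnY (z c) := by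
  induction w with
  | nil => intro c hc; simp only [SimpleGraph.Walk.support_nil, List.mem_singleton] at hc; rwa [hc]
  | cons h w ih =>
    intro c hc
    rw [SimpleGraph.Walk.support_cons, List.mem_cons] at hc
    rcases hc with rfl | hc
    · exact ha
    · exact ih h.2.2.1 c hc

theorem CornerReachable.intMul {q : ℕ} {z : Conf q} {i : Fin q} (h : CornerReachable z i)
    (S : Finset (Fin q)) (hS : ∀ c, OnX (z c) ∨ OnY (z c) → c ∈ S) :
    IntMul (2 ^ (S.card - 1)) (z i).1 ∧ IntMul (2 ^ (S.card - 1)) (z i).2 := by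
  classical
  obtain ⟨c, ⟨hx, hy⟩, ⟨w⟩⟩ := h
  have hlen : w.bypass.length ≤ S.card - 1 := by
    have hsub : w.bypass.support.toFinset ⊆ S := fun d hd =>
      hS d (boundary_of_mem_support _ (Or.inl hx) d (List.mem_toFinset.1 hd))
    have := Finset.card_le_card hsub
    rw [List.toFinset_card_of_nodup w.bypass_isPath.support_nodup,
      SimpleGraph.Walk.length_support] at this
    omega
  have hc : IntMul 1 (z c).1 ∧ IntMul 1 (z c).2 := by
    constructor
    · rcases hx with hx | hx
      · exact ⟨0, by simp [hx]⟩
      · exact ⟨1, by simp [hx]⟩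
    · rcases hy with hy | hy
      · exact ⟨0, by simp [hy]⟩
      · exact ⟨1, by simp [hy]⟩
  have := intMul_of_walk w.bypass hc
  rw [mul_one] at this
  have hdvd := pow_dvd_pow 2 hlen
  exact ⟨this.1.mono hdvd, this.2.mono hdvd⟩

/-- The points of the rigid cycle. -/
def cyclePt : Fin 4 → Pt := ![(1, 1 / 3), (2 / 3, 1), (0, 2 / 3), (1 / 3, 0)]

theorem eq_cyclePt_of_lineDist {p : Pt} (hu : |uval p + 1 / 2| = 5 / 6)
    (hv : |vval p - 3 / 2| = 5 / 6) : ∃ k, p = cyclePt k := by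
  unfold uval at hu
  unfold vval at hv
  rw [abs_eq (by norm_num)] at hu hv
  rcases hu with hu | hu <;> rcases hv with hv | hv
  · exact ⟨0, Prod.ext (by simp [cyclePt]; linarith) (by simp [cyclePt]; linarith)⟩
  · exact ⟨3, Prod.ext (by simp [cyclePt]; linarith) (by simp [cyclePt]; linarith)⟩
  · exact ⟨1, Prod.ext (by simp [cyclePt]; linarith) (by simp [cyclePt]; linarith)⟩
  · exact ⟨2, Prod.ext (by simp [cyclePt]; linarith) (by simp [cyclePt]; linarith)⟩

theorem IsVertex.cornerReachable_or_eq_cyclePt {Bd : Board} (hBd : Bd.set = unitSq) {P : Piece}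
    (hP : P.IsOrthonightrider) {q : ℕ} {z : Conf q} (hz : IsVertex Bd P z)
    {i : Fin q} (hi : OnX (z i) ∨ OnY (z i)) :
    CornerReachable z i ∨ ∃ k, z i = cyclePt k := by
  classical
  by_contra! h
  obtain ⟨α, β, hx, hy, hα, hβ⟩ := exists_deformation
  have hsq : ∀ j, z j ∈ unitSq := fun j => hBd ▸ hz.1 j
  set U : ℝ → Prop := fun t => ∃ a, (OnX (z a) ∨ OnY (z a)) ∧ CornerReachable z a ∧ uval (z a) = t
  set V : ℝ → Prop := fun t => ∃ a, (OnX (z a) ∨ OnY (z a)) ∧ CornerReachable z a ∧ vval (z a) = t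
  have hU : ∀ j, (OnX (z j) ∨ OnY (z j)) → (U (uval (z j)) ↔ CornerReachable z j) := fun j hj =>
    ⟨fun ⟨a, ha, hr, he⟩ => hr.of_line_eq ha hj (Or.inl he), fun hr => ⟨j, hj, hr, rfl⟩⟩
  have hV : ∀ j, (OnX (z j) ∨ OnY (z j)) → (V (vval (z j)) ↔ CornerReachable z j) := fun j hj =>
    ⟨fun ⟨a, ha, hr, he⟩ => hr.of_line_eq ha hj (Or.inr he), fun hr => ⟨j, hj, hr, rfl⟩⟩
  have corner : ∀ j, OnX (z j) → OnY (z j) → CornerReachable z j := fun j h₁ h₂ =>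
    ⟨j, ⟨h₁, h₂⟩, .rfl⟩
  have key := hz.deformation_eq_zero hBd hP (fun t => if U t then 0 else α t)
    (fun t => if V t then 0 else β t) (fun j hj => by
      simp only [hU j (Or.inl hj), hV j (Or.inl hj)]
      split_ifs with hc
      · norm_num
      · exact hx _ (hsq j) hj fun hj' => hc (corner j hj hj')) (fun j hj => by
      simp only [hU j (Or.inr hj), hV j (Or.inr hj)]
      split_ifs with hc
      · norm_num
      · exact hy _ (hsq j) hj fun hj' => hc (corner j hj' hj)) i
  simp only [hU i hi, hV i hi, if_neg h.1] at key
  obtain ⟨k, hk⟩ := eq_cyclePt_of_lineDist (hα _ key.1) (hβ _ key.2)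
  exact h.2 k hk

theorem IsVertex.exists_boundary_of_uval {Bd : Board} (hBd : Bd.set = unitSq) {P : Piece}
    (hP : P.IsOrthonightrider) {q : ℕ} {z : Conf q} (hz : IsVertex Bd P z)
    (j : Fin q) :
    ∃ a, (OnX (z a) ∨ OnY (z a)) ∧ uval (z a) = uval (z j) := by
  by_contra! h
  have := hz.deformation_eq_zero hBd hP (fun t => if t = uval (z j) then 1 else 0) (fun _ => 0)
    (fun i hi => by simp [h i (Or.inl hi)]) (fun i hi => by simp [h i (Or.inr hi)]) j
  simp at this

theorem IsVertex.exists_boundary_of_vval {Bd : Board} (hBd : Bd.set = unitSq) {P : Piece}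
    (hP : P.IsOrthonightrider) {q : ℕ} {z : Conf q} (hz : IsVertex Bd P z)
    (j : Fin q) :
    ∃ a, (OnX (z a) ∨ OnY (z a)) ∧ vval (z a) = vval (z j) := by
  by_contra! h
  have := hz.deformation_eq_zero hBd hP (fun _ => 0) (fun t => if t = vval (z j) then 1 else 0)
    (fun i hi => by simp [h i (Or.inl hi)]) (fun i hi => by simp [h i (Or.inr hi)]) j
  simp at this

/-- The rigid cycle cannot be occupied partially. -/
theorem IsVertex.cyclePt_mem_range {Bd : Board} (hBd : Bd.set = unitSq) {P : Piece}
    (hP : P.IsOrthonightrider) {q : ℕ} {z : Conf q} (hz : IsVertex Bd P z)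
    {i : Fin q} {k : Fin 4} (hi : z i = cyclePt k) (m : Fin 4) :
    ∃ j, z j = cyclePt m := by
  by_contra! h
  have key : ∀ a₁ a₂ b₁ b₂ : ℝ, (m ≠ 0 → a₁ + 2 * b₁ = 0) → (m ≠ 1 → b₁ = 2 * a₂) →
      (m ≠ 2 → a₂ + 2 * b₂ = 0) → (m ≠ 3 → b₂ = 2 * a₁) →
      (![a₁, a₂, a₂, a₁] k = 0) := by
    intro a₁ a₂ b₁ b₂ h₀ h₁ h₂ h₃
    have edge : ∀ j n, z j = cyclePt n → m ≠ n := by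
      rintro j n hj rfl
      exact h j hj
    have hsq : ∀ j, z j ∈ unitSq := fun j => hBd ▸ hz.1 j
    have := hz.deformation_eq_zero hBd hP
      (fun t => if t = 1 / 3 then a₁ else if t = -4 / 3 then a₂ else 0)
      (fun t => if t = 7 / 3 then b₁ else if t = 2 / 3 then b₂ else 0) ?_ ?_ i
    · have h' := this.1
      rw [hi] at h'
      fin_cases k <;> norm_num [cyclePt, uval] at h' ⊢ <;> exact h'
    · intro j hj
      obtain ⟨-, hy₀, hy₁⟩ := mem_unitSq.1 (hsq j)
      have e₀ := edge j 0
      have e₂ := edge j 2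
      generalize z j = p at *
      obtain ⟨x, y⟩ := p
      simp only [cyclePt, Matrix.cons_val, Prod.mk.injEq] at *
      rcases hj with rfl | rfl
      · have hu : uval (0, y) = -2 * y := by simp [uval]
        have hv : vval (0, y) = y := by simp [vval]
        rw [hu, hv, if_neg (c := -2 * y = 1 / 3) (by linarith),
          if_neg (c := y = 7 / 3) (by linarith)]
        by_cases hy : y = 2 / 3
        · rw [if_pos (by linarith), if_pos hy]
          exact h₂ (e₂ ⟨rfl, hy⟩)
        · rw [if_neg (fun h => hy (by linarith)), if_neg hy]
          norm_num
      · have hu : uval (1, y) = 1 - 2 * y := by simp [uval]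
        have hv : vval (1, y) = 2 + y := by simp [vval]
        rw [hu, hv, if_neg (c := 1 - 2 * y = -4 / 3) (by linarith),
          if_neg (c := 2 + y = 2 / 3) (by linarith)]
        by_cases hy : y = 1 / 3
        · rw [if_pos (by linarith), if_pos (by linarith)]
          exact h₀ (e₀ ⟨rfl, hy⟩)
        · rw [if_neg (fun h => hy (by linarith)), if_neg (fun h => hy (by linarith))]
          norm_num
    · intro j hj
      obtain ⟨⟨hx₀, hx₁⟩, -⟩ := mem_unitSq.1 (hsq j)
      have e₁ := edge j 1
      have e₃ := edge j 3
      generalize z j = p at *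
      obtain ⟨x, y⟩ := p
      simp only [cyclePt, Matrix.cons_val, Prod.mk.injEq] at *
      rcases hj with rfl | rfl
      · have hu : uval (x, 0) = x := by simp [uval]
        have hv : vval (x, 0) = 2 * x := by simp [vval]
        rw [hu, hv, if_neg (c := x = -4 / 3) (by linarith),
          if_neg (c := 2 * x = 7 / 3) (by linarith)]
        by_cases hx : x = 1 / 3
        · rw [if_pos (by linarith), if_pos hx]
          exact h₃ (e₃ ⟨hx, rfl⟩)
        · rw [if_neg (fun h => hx (by linarith)), if_neg hx]
          norm_num
      · have hu : uval (x, 1) = x - 2 := by simp [uval]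
        have hv : vval (x, 1) = 2 * x + 1 := by simp [vval]
        rw [hu, hv, if_neg (c := x - 2 = 1 / 3) (by linarith),
          if_neg (c := 2 * x + 1 = 2 / 3) (by linarith)]
        by_cases hx : x = 2 / 3
        · rw [if_pos (by linarith), if_pos (by linarith)]
          exact h₁ (e₁ ⟨hx, rfl⟩)
        · rw [if_neg (fun h => hx (by linarith)), if_neg (fun h => hx (by linarith))]
          norm_num
  obtain rfl | rfl | rfl | rfl : m = 0 ∨ m = 1 ∨ m = 2 ∨ m = 3 := by omega
  · have := key 1 (-4) (-8) 2 (absurd rfl) (by norm_num) (by norm_num) (by norm_num)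
    fin_cases k <;> norm_num at this
  · have := key (-2) 8 1 (-4) (by norm_num) (absurd rfl) (by norm_num) (by norm_num)
    fin_cases k <;> norm_num at this
  · have := key (-4) 1 2 (-8) (by norm_num) (by norm_num) (absurd rfl) (by norm_num)
    fin_cases k <;> norm_num at this
  · have := key 8 (-2) (-4) 1 (by norm_num) (by norm_num) (by norm_num) (absurd rfl)
    fin_cases k <;> norm_num at this

theorem IsVertex.four_le_of_eq_cyclePt {Bd : Board} (hBd : Bd.set = unitSq) {P : Piece}
    (hP : P.IsOrthonightrider) {q : ℕ} {z : Conf q} (hz : IsVertex Bd P z)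
    {i : Fin q} {k : Fin 4} (hi : z i = cyclePt k) :
    4 ≤ q := by
  choose f hf using hz.cyclePt_mem_range hBd hP hi
  have hinj : Function.Injective f := by
    intro a b hab
    have h : cyclePt a = cyclePt b := by rw [← hf, ← hf, hab]
    fin_cases a <;> fin_cases b <;> first | rfl | (norm_num [cyclePt] at h)
  simpa using Fintype.card_le_of_injective f hinj

theorem IsVertex.intMul_of_boundary {Bd : Board} (hBd : Bd.set = unitSq) {P : Piece}
    (hP : P.IsOrthonightrider) {q : ℕ} {z : Conf q} (hz : IsVertex Bd P z)
    (S : Finset (Fin q))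
    (hS : ∀ c, OnX (z c) ∨ OnY (z c) → c ∈ S) {i : Fin q} (hi : OnX (z i) ∨ OnY (z i)) :
    (IntMul (2 ^ (S.card - 1)) (z i).1 ∧ IntMul (2 ^ (S.card - 1)) (z i).2) ∨
      4 ≤ q ∧ IntMul 3 (z i).1 ∧ IntMul 3 (z i).2 := by
  rcases hz.cornerReachable_or_eq_cyclePt hBd hP hi with h | ⟨k, hk⟩
  · exact Or.inl (h.intMul S hS)
  · refine Or.inr ⟨hz.four_le_of_eq_cyclePt hBd hP hk, ?_⟩
    rw [hk]
    unfold IntMul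
    fin_cases k
    · exact ⟨⟨3, by norm_num [cyclePt]⟩, ⟨1, by norm_num [cyclePt]⟩⟩
    · exact ⟨⟨2, by norm_num [cyclePt]⟩, ⟨3, by norm_num [cyclePt]⟩⟩
    · exact ⟨⟨0, by norm_num [cyclePt]⟩, ⟨2, by norm_num [cyclePt]⟩⟩
    · exact ⟨⟨1, by norm_num [cyclePt]⟩, ⟨0, by norm_num [cyclePt]⟩⟩

theorem IsVertex.intMul_of_not_boundary {Bd : Board} (hBd : Bd.set = unitSq) {P : Piece}
    (hP : P.IsOrthonightrider) {q : ℕ} {z : Conf q} (hz : IsVertex Bd P z)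
    {j : Fin q} (hj : ¬ (OnX (z j) ∨ OnY (z j))) :
    3 ≤ q ∧ ∀ N, 2 ^ (q - 2) ∣ N → (4 ≤ q → 3 ∣ N) →
      IntMul (5 * N) (z j).1 ∧ IntMul (5 * N) (z j).2 := by
  classical
  obtain ⟨a, ha, hau⟩ := hz.exists_boundary_of_uval hBd hP j
  obtain ⟨b, hb, hbv⟩ := hz.exists_boundary_of_vval hBd hP j
  have haj : a ≠ j := by rintro rfl; exact hj ha
  have hbj : b ≠ j := by rintro rfl; exact hj hb
  have hab : a ≠ b := by
    rintro rfl
    rw [eq_of_uval_eq_of_vval_eq hau hbv] at ha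
    exact hj ha
  constructor
  · have := Finset.card_le_univ ({a, b, j} : Finset (Fin q))
    rw [Finset.card_eq_three.2 ⟨a, b, j, hab, haj, hbj, rfl⟩, Fintype.card_fin] at this
    exact this
  · intro N hN hN'
    have hcard : (Finset.univ.erase j).card - 1 = q - 2 := by
      rw [Finset.card_erase_of_mem (Finset.mem_univ _), Finset.card_univ, Fintype.card_fin]
      omega
    have bound : ∀ i, OnX (z i) ∨ OnY (z i) → IntMul N (uval (z i)) ∧ IntMul N (vval (z i)) := by
      intro i hi
      apply IntMul.uval_vval
      rcases hz.intMul_of_boundary hBd hP (Finset.univ.erase j) (fun c hc => by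
        simp only [Finset.mem_erase, Finset.mem_univ, and_true]
        rintro rfl
        exact hj hc) hi with h | ⟨hq, h⟩
      · rw [hcard] at h
        exact ⟨h.1.mono hN, h.2.mono hN⟩
      · exact ⟨h.1.mono (hN' hq), h.2.mono (hN' hq)⟩
    apply IntMul.of_uval_vval
    · rw [← hau]; exact (bound a ha).1
    · rw [← hbv]; exact (bound b hb).2

/-! ### Vertices with large denominators -/

/-- The position along the edge of the points of a corner trajectory. -/
def trajPos : ℕ → ℝ
  | 0 => 0
  | n + 1 => (1 - trajPos n) / 2

theorem trajPos_nonneg_le_one (n : ℕ) : 0 ≤ trajPos n ∧ trajPos n ≤ 1 := by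
  induction n with
  | zero => simp [trajPos]
  | succ n ih => rw [trajPos]; constructor <;> linarith

theorem exists_odd_eq_two_pow_mul_trajPos (n : ℕ) :
    ∃ a : ℕ, Odd a ∧ (2 : ℝ) ^ (n + 1) * trajPos (n + 1) = a := by
  induction n with
  | zero => exact ⟨1, odd_one, by norm_num [trajPos]⟩
  | succ n ih =>
    obtain ⟨a, ha, h⟩ := ih
    have hle : a ≤ 2 ^ (n + 1) := by
      have : (a : ℝ) ≤ 2 ^ (n + 1) := by
        rw [← h]
        exact mul_le_of_le_one_right (by positivity) (trajPos_nonneg_le_one _).2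
      exact_mod_cast this
    refine ⟨2 ^ (n + 1) - a, Nat.Even.sub_odd hle (even_two.pow_of_ne_zero (by omega)) ha, ?_⟩
    rw [trajPos, Nat.cast_sub hle, ← h, pow_succ]
    push_cast
    ring

/-- The trajectory starting in the corner `(1, 0)`. -/
def trajPt (n : ℕ) : Pt :=
  if n % 4 = 0 then (1, trajPos n) else if n % 4 = 1 then (1 - trajPos n, 1)
  else if n % 4 = 2 then (0, 1 - trajPos n) else (trajPos n, 0)

theorem trajPt_mem (n : ℕ) : trajPt n ∈ unitSq := by
  have := trajPos_nonneg_le_one n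
  unfold trajPt
  rw [mem_unitSq]
  split_ifs <;> refine ⟨⟨?_, ?_⟩, ?_, ?_⟩ <;> simp only <;> linarith

theorem dvd_of_intMul_trajPt {n D : ℕ} (h : IntMul D (trajPt n).1 ∧ IntMul D (trajPt n).2) :
    2 ^ n ∣ D := by
  cases n with
  | zero => simp
  | succ n =>
    have hpos : IntMul D (trajPos (n + 1)) := by
      have hsub : ∀ x, IntMul D (1 - x) → IntMul D x := fun x ⟨k, hk⟩ =>
        ⟨D - k, by push_cast; linarith⟩
      unfold trajPt at h
      split_ifs at h
      · exact h.2
      · exact hsub _ h.1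
      · exact hsub _ h.2
      · exact h.1
    obtain ⟨a, ha, hr⟩ := exists_odd_eq_two_pow_mul_trajPos n
    exact IntMul.dvd_of_coprime (Nat.Coprime.pow_left _ (Nat.coprime_two_left.2 ha))
      (by push_cast; exact hr) hpos

theorem isVertex_trajPt {Bd : Board} (hBd : Bd.set = unitSq) {P : Piece}
    (hP : P.IsOrthonightrider) (q : ℕ) : IsVertex Bd P (fun i : Fin q => trajPt i) := by
  refine isVertex_of_unique hBd hP (fun i => trajPt_mem i) fun w hu hv hx hy => ?_
  have key : ∀ n (hn : n < q), w ⟨n, hn⟩ = trajPt n := by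
    intro n
    induction n with
    | zero =>
      intro hn
      exact Prod.ext (hx ⟨0, hn⟩ (by simp [trajPt, OnX])) (hy ⟨0, hn⟩ (by simp [trajPt, trajPos, OnY]))
    | succ n ih =>
      intro hn
      have ih := ih (by omega)
      have hu := hu ⟨n + 1, hn⟩ ⟨n, by omega⟩
      have hv := hv ⟨n + 1, hn⟩ ⟨n, by omega⟩
      have hx := hx ⟨n + 1, hn⟩
      have hy := hy ⟨n + 1, hn⟩
      simp only [ih] at hu hv hx hy
      generalize w ⟨n + 1, hn⟩ = p at *
      obtain ⟨x, y⟩ := p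
      have hmod : n % 4 = 0 ∨ n % 4 = 1 ∨ n % 4 = 2 ∨ n % 4 = 3 := by omega
      rcases hmod with h | h | h | h
      · have h' : (n + 1) % 4 = 1 := by omega
        simp only [trajPt, trajPos, h, h', uval, vval, OnX, OnY] at hu hv hx hy ⊢
        norm_num at hu hv hx hy ⊢
        have := hv (by ring)
        constructor <;> linarith
      · have h' : (n + 1) % 4 = 2 := by omega
        simp only [trajPt, trajPos, h, h', uval, vval, OnX, OnY] at hu hv hx hy ⊢
        norm_num at hu hv hx hy ⊢
        have := hu (by ring)
        constructor <;> linarith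
      · have h' : (n + 1) % 4 = 3 := by omega
        simp only [trajPt, trajPos, h, h', uval, vval, OnX, OnY] at hu hv hx hy ⊢
        norm_num at hu hv hx hy ⊢
        have := hv (by ring)
        constructor <;> linarith
      · have h' : (n + 1) % 4 = 0 := by omega
        simp only [trajPt, trajPos, h, h', uval, vval, OnX, OnY] at hu hv hx hy ⊢
        norm_num at hu hv hx hy ⊢
        have := hu (by ring)
        constructor <;> linarith
  funext i
  exact key i i.2

/-- Two corners and the crossing of the lines through them. -/
def crossingPt (n : ℕ) : Pt := if n = 1 then (1, 0) else if n = 2 then (4 / 5, 2 / 5) else (0, 0)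

theorem isVertex_crossingPt {Bd : Board} (hBd : Bd.set = unitSq) {P : Piece}
    (hP : P.IsOrthonightrider) {q : ℕ} (hq : 3 ≤ q) :
    IsVertex Bd P (fun i : Fin q => crossingPt i) := by
  refine isVertex_of_unique hBd hP (fun i => ?_) fun w hu hv hx hy => ?_
  · simp only [crossingPt]
    split_ifs <;> norm_num [mem_unitSq]
  have corner : ∀ i : Fin q, (i : ℕ) ≠ 2 → w i = crossingPt i := fun i hi => by
    have hx := hx i
    have hy := hy i
    simp only [crossingPt, if_neg hi] at hx hy ⊢
    split_ifs at hx hy ⊢ <;>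
      exact Prod.ext (hx (by norm_num [OnX])) (hy (by norm_num [OnY]))
  funext i
  rcases eq_or_ne (i : ℕ) 2 with hi | hi
  · have hu := hu i ⟨0, by omega⟩
    have hv := hv i ⟨1, by omega⟩
    rw [corner ⟨0, by omega⟩ (by norm_num)] at hu
    rw [corner ⟨1, by omega⟩ (by norm_num)] at hv
    refine eq_of_uval_eq_of_vval_eq ?_ ?_
    · simp only [hi] at hu ⊢
      norm_num [crossingPt, uval] at hu ⊢
      exact hu
    · simp only [hi] at hv ⊢
      norm_num [crossingPt, vval] at hv ⊢
      exact hv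
  · exact corner i hi

theorem isVertex_cyclePt {Bd : Board} (hBd : Bd.set = unitSq) {P : Piece}
    (hP : P.IsOrthonightrider) {q : ℕ} (hq : 4 ≤ q) :
    IsVertex Bd P (fun i : Fin q => if h : (i : ℕ) < 4 then cyclePt ⟨i, h⟩ else (0, 0)) := by
  refine isVertex_of_unique hBd hP (fun i => ?_) fun w hu hv hx hy => ?_
  · split_ifs with h
    · generalize (⟨i, h⟩ : Fin 4) = k
      fin_cases k <;> norm_num [cyclePt, mem_unitSq]
    · norm_num [mem_unitSq]
  have h0 := hx ⟨0, by omega⟩ (by norm_num [cyclePt, OnX])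
  have h1 := hy ⟨1, by omega⟩ (by norm_num [cyclePt, OnY])
  have h2 := hx ⟨2, by omega⟩ (by norm_num [cyclePt, OnX])
  have h3 := hy ⟨3, by omega⟩ (by norm_num [cyclePt, OnY])
  have h01 := hv ⟨0, by omega⟩ ⟨1, by omega⟩ (by norm_num [cyclePt, vval])
  have h12 := hu ⟨1, by omega⟩ ⟨2, by omega⟩ (by norm_num [cyclePt, uval])
  have h23 := hv ⟨2, by omega⟩ ⟨3, by omega⟩ (by norm_num [cyclePt, vval])
  have h30 := hu ⟨3, by omega⟩ ⟨0, by omega⟩ (by norm_num [cyclePt, uval])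
  norm_num [cyclePt, uval, vval] at h0 h1 h2 h3 h01 h12 h23 h30
  funext i
  by_cases h : (i : ℕ) < 4
  · obtain ⟨i, hi⟩ := i
    simp only at h
    interval_cases i <;> norm_num [cyclePt] <;> refine Prod.ext ?_ ?_ <;> simp only <;> linarith
  · have hx := hx i
    have hy := hy i
    simp only [dif_neg h] at hx hy ⊢
    exact Prod.ext (hx (by norm_num [OnX])) (hy (by norm_num [OnY]))

/-- The denominator of the inside-out polytope for the orthonightrider, with moves
`(2,1)` and `(1,-2)`, on the square board. -/
theorem iopDenom_orthonightrider (Bd : Board) (hBd : Bd.set = unitSq)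
    (P : Piece) (h1 : P.c false = 2) (h2 : P.d false = 1)
    (h3 : P.c true = 1) (h4 : P.d true = -2)
    (q : ℕ) (hq : 1 ≤ q) :
    IsIOPDenom Bd P q
      (if q = 1 then 1 else if q = 2 then 2 else if q = 3 then 20
       else 15 * 2 ^ (q - 1)) := by
  have hP : P.IsOrthonightrider := ⟨h1, h2, h3, h4⟩
  constructor
  · intro z hz i
    have hD : (if q = 1 then 1 else if q = 2 then 2 else if q = 3 then 20
       else 15 * 2 ^ (q - 1)) ≠ 0 := by
      split_ifs <;> positivity
    suffices h : ∀ D : ℕ, D = (if q = 1 then 1 else if q = 2 then 2 else if q = 3 then 20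
        else 15 * 2 ^ (q - 1)) → IntMul D (z i).1 ∧ IntMul D (z i).2 from
      ⟨(h _ rfl).1.denDvd hD, (h _ rfl).2.denDvd hD⟩
    rintro D rfl
    by_cases hi : OnX (z i) ∨ OnY (z i)
    · rcases hz.intMul_of_boundary hBd hP Finset.univ (fun c _ => Finset.mem_univ c) hi with
        h | ⟨h4q, h⟩
      · rw [Finset.card_univ, Fintype.card_fin] at h
        have hdvd : 2 ^ (q - 1) ∣ (if q = 1 then 1 else if q = 2 then 2 else if q = 3 then 20
            else 15 * 2 ^ (q - 1)) := by
          split_ifs with h₁ h₂ h₃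
          · subst h₁; norm_num
          · subst h₂; norm_num
          · subst h₃; norm_num
          · exact Dvd.intro_left _ rfl
        exact ⟨h.1.mono hdvd, h.2.mono hdvd⟩
      · rw [if_neg (by omega), if_neg (by omega), if_neg (by omega)]
        have hdvd : 3 ∣ 15 * 2 ^ (q - 1) := Dvd.dvd.mul_right (by norm_num) _
        exact ⟨h.1.mono hdvd, h.2.mono hdvd⟩
    · obtain ⟨h3q, h⟩ := hz.intMul_of_not_boundary hBd hP hi
      rw [if_neg (by omega), if_neg (by omega)]
      split_ifs with h₃
      · subst h₃
        exact h 4 (by norm_num) (by norm_num)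
      · have := h (3 * 2 ^ (q - 1)) (Dvd.dvd.mul_left (pow_dvd_pow 2 (by omega)) _)
          (fun _ => Dvd.intro _ rfl)
        rwa [← mul_assoc] at this
  · intro D hD
    have two : 2 ^ (q - 1) ∣ D := by
      have := hD _ (isVertex_trajPt hBd hP q) ⟨q - 1, by omega⟩
      exact dvd_of_intMul_trajPt ⟨this.1.intMul, this.2.intMul⟩
    have five : 3 ≤ q → 5 ∣ D := fun hq => by
      have := (hD _ (isVertex_crossingPt hBd hP hq) ⟨2, by omega⟩).1.intMul
      exact IntMul.dvd_of_coprime (a := 4) (by norm_num) (by norm_num [crossingPt]) this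
    have three : 4 ≤ q → 3 ∣ D := fun hq => by
      have := (hD _ (isVertex_cyclePt hBd hP hq) ⟨0, by omega⟩).2.intMul
      exact IntMul.dvd_of_coprime (a := 1) (by norm_num) (by norm_num [cyclePt]) this
    split_ifs with h₁ h₂ h₃
    · exact one_dvd _
    · subst h₂; simpa using two
    · subst h₃
      exact Nat.Coprime.mul_dvd_of_dvd_of_dvd (m := 4) (n := 5) (by norm_num)
        (by simpa using two) (five le_rfl)
    · have h15 : 15 ∣ D := Nat.Coprime.mul_dvd_of_dvd_of_dvd (m := 3) (n := 5) (by norm_num)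
        (three (by omega)) (five (by omega))
      exact Nat.Coprime.mul_dvd_of_dvd_of_dvd (Nat.Coprime.pow_right _ (by norm_num)) h15 two

end
end

section
/- Let B be a board (rational convex polygon) and ℙ a piece with two basic moves. Every corner trajectory has full rank: if T = [b₁,…,b_l] is a trajectory that contains a corner of B, then the point (b₁,…,b_l) ∈ B^l has rank 2l. -/
noncomputable section

open Filter Topology

theorem continuous_dotp (u : Pt) : Continuous (dotp u) := by
  unfold dotp
  fun_prop

theorem dotp_add_smul (a x u : Pt) (t : ℝ) :
    dotp a (x + t • u) = dotp a x + t * dotp a u := by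
  simp only [dotp, Prod.fst_add, Prod.snd_add, Prod.smul_fst, Prod.smul_snd, smul_eq_mul]
  ring

/-- Two vectors with nonzero determinant span the plane. -/
theorem submodule_eq_top_of_det_ne_zero (W : Submodule ℝ Pt) {u v : Pt} (hu : u ∈ W)
    (hv : v ∈ W) (h : u.1 * v.2 - u.2 * v.1 ≠ 0) : W = ⊤ := by
  rw [Submodule.eq_top_iff']
  intro w
  have hw : w = ((w.1 * v.2 - w.2 * v.1) / (u.1 * v.2 - u.2 * v.1)) • u +
      ((u.1 * w.2 - u.2 * w.1) / (u.1 * v.2 - u.2 * v.1)) • v := by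
    ext <;> simp only [Prod.fst_add, Prod.snd_add, Prod.smul_fst, Prod.smul_snd, smul_eq_mul] <;>
      rw [div_mul_eq_mul_div, div_mul_eq_mul_div, ← add_div, eq_div_iff h] <;> ring
  rw [hw]
  exact W.add_mem (W.smul_mem _ hu) (W.smul_mem _ hv)

theorem Board.isClosed_set (Bd : Board) : IsClosed Bd.set := by
  have : Bd.set = ⋂ j, {z | dotp (Bd.A j) z ≤ Bd.β j} := by
    ext z
    simp [Board.set]
  rw [this]
  exact isClosed_iInter fun j => isClosed_le (continuous_dotp _) continuous_const

/-- Constraints inactive at a point of the board stay inactive nearby. -/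
theorem Board.eventually_inactive (Bd : Board) {x : Pt} (hx : x ∈ Bd.set) :
    ∀ᶠ y in 𝓝 x, ∀ e, dotp (Bd.A e) x ≠ Bd.β e → dotp (Bd.A e) y < Bd.β e := by
  rw [eventually_all]
  intro e
  by_cases h : dotp (Bd.A e) x = Bd.β e
  · simp [h]
  · filter_upwards [(continuous_dotp (Bd.A e)).continuousAt.eventually_lt_const
      (lt_of_le_of_ne (hx e) h)] with y hy _ using hy

/-- A boundary point of the board lies on an edge with nonzero normal. -/
theorem Board.exists_active_ne_zero (Bd : Board) {x : Pt} (hx : x ∈ frontier Bd.set) :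
    ∃ e, dotp (Bd.A e) x = Bd.β e ∧ Bd.A e ≠ 0 := by
  by_contra! hcon
  have hxB : x ∈ Bd.set := Bd.isClosed_set.frontier_subset hx
  refine hx.2 (mem_interior_iff_mem_nhds.2 ?_)
  filter_upwards [Bd.eventually_inactive hxB] with y hy e
  by_cases h : dotp (Bd.A e) x = Bd.β e
  · rw [← h, hcon e h]
    simp [dotp]
  · exact (hy e h).le

/-- A nontrivial constraint is strict in the interior of the board. -/
theorem Board.dotp_lt_of_mem_interior (Bd : Board) {y : Pt} (hy : y ∈ interior Bd.set)
    {e : Fin Bd.s} (he : Bd.A e ≠ 0) : dotp (Bd.A e) y < Bd.β e := by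
  have hc : Continuous fun t : ℝ => y + t • Bd.A e := by fun_prop
  have h0 : ∀ᶠ t in 𝓝 (0 : ℝ), y + t • Bd.A e ∈ Bd.set :=
    hc.continuousAt.eventually (by simpa using mem_interior_iff_mem_nhds.1 hy)
  obtain ⟨t, ht, htpos⟩ :=
    ((h0.filter_mono nhdsWithin_le_nhds).and (self_mem_nhdsWithin (s := Set.Ioi (0 : ℝ)))).exists
  have h1 := ht e
  rw [dotp_add_smul] at h1
  have h2 : 0 < dotp (Bd.A e) (Bd.A e) := by
    have : (Bd.A e).1 ≠ 0 ∨ (Bd.A e).2 ≠ 0 := by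
      by_contra! h
      exact he (Prod.ext h.1 h.2)
    unfold dotp
    rcases this with h | h
    · nlinarith [mul_self_pos.2 h, mul_self_nonneg (Bd.A e).2]
    · nlinarith [mul_self_pos.2 h, mul_self_nonneg (Bd.A e).1]
  have := mul_pos (show 0 < t from htpos) h2
  linarith

/-- At a corner no nonzero direction is tangent to all active edges. -/
theorem Board.eq_zero_of_mem_corners (Bd : Board) {x : Pt} (hx : x ∈ Bd.corners) {u : Pt}
    (hu : ∀ e, dotp (Bd.A e) x = Bd.β e → dotp (Bd.A e) u = 0) : u = 0 := by
  have key : ∀ w : Pt, (∀ e, dotp (Bd.A e) x = Bd.β e → dotp (Bd.A e) w = 0) →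
      ∀ᶠ t in 𝓝 (0 : ℝ), x + t • w ∈ Bd.set := by
    intro w hw
    have hc : Continuous fun t : ℝ => x + t • w := by fun_prop
    filter_upwards [(hc.tendsto' 0 x (by simp)).eventually
      (Bd.eventually_inactive hx.1)] with t ht e
    by_cases he : dotp (Bd.A e) x = Bd.β e
    · rw [dotp_add_smul, hw e he, he]
      simp
    · exact (ht e he).le
  have hneg : ∀ e, dotp (Bd.A e) x = Bd.β e → dotp (Bd.A e) (-u) = 0 := by
    intro e he
    have := hu e he
    simp only [dotp, Prod.fst_neg, Prod.snd_neg] at this ⊢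
    linarith
  obtain ⟨t, ⟨h1, h2⟩, ht⟩ := ((((key u hu).and (key (-u) hneg)).filter_mono
    nhdsWithin_le_nhds).and (self_mem_nhdsWithin (s := Set.Ioi (0 : ℝ)))).exists
  have ht : 0 < t := ht
  have hmem : x ∈ openSegment ℝ (x + t • u) (x + t • -u) :=
    ⟨1 / 2, 1 / 2, by norm_num, by norm_num, by norm_num, by module⟩
  have h3 : x + t • u = x := hx.2 h1 h2 hmem
  simpa [ht.ne'] using h3

/-- Two active edges at a corner have nonparallel normals. -/
theorem Board.exists_active_det_ne_zero (Bd : Board) {x : Pt} (hx : x ∈ Bd.corners) :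
    ∃ e f, dotp (Bd.A e) x = Bd.β e ∧ dotp (Bd.A f) x = Bd.β f ∧
      (Bd.A e).1 * (Bd.A f).2 - (Bd.A e).2 * (Bd.A f).1 ≠ 0 := by
  by_contra! hcon
  by_cases h : ∃ e, dotp (Bd.A e) x = Bd.β e ∧ Bd.A e ≠ 0
  · obtain ⟨e, he, hne⟩ := h
    have h0 := Bd.eq_zero_of_mem_corners hx (u := (-(Bd.A e).2, (Bd.A e).1)) (by
      intro f hf
      have := hcon e f he hf
      simp only [dotp]
      linarith)
    simp only [Prod.mk_eq_zero, neg_eq_zero] at h0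
    exact hne (Prod.ext h0.2 h0.1)
  · push Not at h
    have h0 := Bd.eq_zero_of_mem_corners hx (u := (1, 0)) (by
      intro f hf
      rw [h f hf]
      simp [dotp])
    simp at h0

/-- An edge active at a boundary point of a line that meets the interior is not parallel to
the line. -/
theorem Board.dotp_ne_zero_of_meetsInterior (Bd : Board) {x v : Pt}
    (hm : meetsInterior Bd.set v x) {e : Fin Bd.s} (he : dotp (Bd.A e) x = Bd.β e)
    (hne : Bd.A e ≠ 0) : dotp (Bd.A e) v ≠ 0 := by
  intro h
  obtain ⟨t, ht⟩ := hm
  have := Bd.dotp_lt_of_mem_interior ht hne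
  rw [dotp_add_smul, h, he] at this
  simp at this

theorem unitVec_eq_single {q : ℕ} (i : Fin q) (v : Pt) :
    unitVec i v = LinearMap.single ℝ (fun _ : Fin q => Pt) i v := by
  ext k : 1
  simp [unitVec, Pi.single_apply]

theorem attackNormal_eq_sub {q : ℕ} {i j : Fin q} (h : i ≠ j) (v : Pt) :
    attackNormal i j v = unitVec i v - unitVec j v := by
  ext k : 1
  by_cases hi : k = i
  · subst hi
    simp [attackNormal, unitVec, h]
  · simp [attackNormal, unitVec, hi]
    split_ifs <;> simp

/-- The span of the normal vectors of the arrangement `H(z)`. -/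
def normalSpan (Bd : Board) (P : Piece) {q : ℕ} (z : Conf q) : Submodule ℝ (Conf q) :=
  Submodule.span ℝ (Prod.fst '' HArr Bd P z)

/-- The planar vectors `v` such that placing `v` in component `i` gives an element of the
span of the normal vectors of `H(z)`. -/
def componentSpan (Bd : Board) (P : Piece) {q : ℕ} (z : Conf q) (i : Fin q) :
    Submodule ℝ Pt :=
  (normalSpan Bd P z).comap (LinearMap.single ℝ (fun _ : Fin q => Pt) i)

theorem mem_componentSpan {Bd : Board} {P : Piece} {q : ℕ} {z : Conf q} {i : Fin q} {v : Pt} :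
    v ∈ componentSpan Bd P z i ↔ unitVec i v ∈ normalSpan Bd P z := by
  rw [unitVec_eq_single]
  rfl

theorem fixation_mem_componentSpan {Bd : Board} (P : Piece) {q : ℕ} {z : Conf q} {i : Fin q}
    {e : Fin Bd.s} (he : dotp (Bd.A e) (z i) = Bd.β e) :
    Bd.A e ∈ componentSpan Bd P z i :=
  mem_componentSpan.2 (Submodule.subset_span ⟨_, Or.inr ⟨i, e, he, rfl⟩, rfl⟩)

/-- Attacking pieces have the attack normal in both or in neither of their component spans. -/
theorem anorm_mem_componentSpan_iff {Bd : Board} {P : Piece} {q : ℕ} {z : Conf q}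
    {i j : Fin q} (hij : i < j) {r : Bool} (h : dotp (z i - z j) (P.anorm r) = 0) :
    P.anorm r ∈ componentSpan Bd P z i ↔ P.anorm r ∈ componentSpan Bd P z j := by
  have hmem : unitVec i (P.anorm r) - unitVec j (P.anorm r) ∈ normalSpan Bd P z := by
    rw [← attackNormal_eq_sub hij.ne]
    exact Submodule.subset_span ⟨_, Or.inl ⟨i, j, r, hij, h, rfl⟩, rfl⟩
  rw [mem_componentSpan, mem_componentSpan]
  constructor <;> intro hv
  · simpa using Submodule.sub_mem _ hv hmem
  · simpa using Submodule.add_mem _ hmem hv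

theorem componentSpan_eq_top_of_corner {Bd : Board} (P : Piece) {q : ℕ} {z : Conf q}
    {i : Fin q} (hc : z i ∈ Bd.corners) : componentSpan Bd P z i = ⊤ := by
  obtain ⟨e, f, he, hf, hdet⟩ := Bd.exists_active_det_ne_zero hc
  exact submodule_eq_top_of_det_ne_zero _ (fixation_mem_componentSpan P he)
    (fixation_mem_componentSpan P hf) hdet

theorem componentSpan_eq_top_of_anorm_mem {Bd : Board} {P : Piece} {q : ℕ} {z : Conf q}
    {i : Fin q} {r : Bool} (hf : z i ∈ frontier Bd.set)
    (hm : meetsInterior Bd.set (P.mv r) (z i)) (ha : P.anorm r ∈ componentSpan Bd P z i) :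
    componentSpan Bd P z i = ⊤ := by
  obtain ⟨e, he, hne⟩ := Bd.exists_active_ne_zero hf
  have h := Bd.dotp_ne_zero_of_meetsInterior hm he hne
  refine submodule_eq_top_of_det_ne_zero _ ha (fixation_mem_componentSpan P he) ?_
  simp only [dotp, Piece.mv, Piece.anorm] at h ⊢
  contrapose! h
  linarith

/-- Consecutive distinct boundary points related by the antipode map have full component
spans simultaneously. -/
theorem componentSpan_eq_top_iff_of_antipRel {Bd : Board} {P : Piece} {q : ℕ} {z : Conf q}
    {i j : Fin q} (hij : i < j) {r : Bool} (hi : z i ∈ frontier Bd.set)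
    (hj : z j ∈ frontier Bd.set) (hne : z j ≠ z i)
    (hr : AntipRel Bd.set (P.mv r) (z i) (z j)) :
    componentSpan Bd P z i = ⊤ ↔ componentSpan Bd P z j = ⊤ := by
  have hm : meetsInterior Bd.set (P.mv r) (z i) := by
    by_contra h
    exact hne (hr.1 h)
  obtain ⟨-, -, t, ht⟩ := hr.2 hm
  have hm' : meetsInterior Bd.set (P.mv r) (z j) := by
    obtain ⟨s, hs⟩ := hm
    refine ⟨s - t, ?_⟩
    rw [ht]
    convert hs using 1
    module
  have hd : dotp (z i - z j) (P.anorm r) = 0 := by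
    rw [ht]
    simp only [dotp, Piece.mv, Piece.anorm, Prod.fst_sub, Prod.snd_sub, Prod.fst_add,
      Prod.snd_add, Prod.smul_fst, Prod.smul_snd, smul_eq_mul]
    ring
  have hiff := anorm_mem_componentSpan_iff (Bd := Bd) hij hd
  exact ⟨fun h => componentSpan_eq_top_of_anorm_mem hj hm' (hiff.1 (h ▸ Submodule.mem_top)),
    fun h => componentSpan_eq_top_of_anorm_mem hi hm (hiff.2 (h ▸ Submodule.mem_top))⟩

theorem confRank_eq_of_componentSpan_eq_top {Bd : Board} {P : Piece} {q : ℕ} {z : Conf q}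
    (h : ∀ i, componentSpan Bd P z i = ⊤) : confRank Bd P z = 2 * q := by
  have htop : normalSpan Bd P z = ⊤ := by
    rw [Submodule.eq_top_iff']
    intro w
    rw [← Finset.univ_sum_single w]
    refine Submodule.sum_mem _ fun i _ => ?_
    have hi : w i ∈ componentSpan Bd P z i := h i ▸ Submodule.mem_top
    exact hi
  have hrank : confRank Bd P z = Module.finrank ℝ (normalSpan Bd P z) := rfl
  rw [hrank, htop, finrank_top, Module.finrank_pi_fintype]
  simp [mul_comm]

/-- Corner trajectories have full rank. -/
theorem cornerTraj_fullRank (Bd : Board) (P : Piece) (l : ℕ) (b : ℕ → Pt) (st : Bool)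
    (hT : IsCornerTraj Bd P l b st) :
    confRank Bd P (trajConf l b) = 2 * l := by
  obtain ⟨⟨-, hfr, hinj, hstep⟩, k, hk, hcor⟩ := hT
  have hadj : ∀ i (hi : i + 1 < l),
      (componentSpan Bd P (trajConf l b) ⟨i, by omega⟩ = ⊤ ↔
        componentSpan Bd P (trajConf l b) ⟨i + 1, hi⟩ = ⊤) := by
    intro i hi
    refine componentSpan_eq_top_iff_of_antipRel (Fin.mk_lt_mk.2 i.lt_succ_self)
      (hfr i (by omega)) (hfr (i + 1) hi) ?_ (hstep i hi)
    intro h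
    have := hinj (i + 1) i hi (by omega) h
    omega
  have hzero : ∀ i (hi : i < l),
      (componentSpan Bd P (trajConf l b) ⟨0, by omega⟩ = ⊤ ↔
        componentSpan Bd P (trajConf l b) ⟨i, hi⟩ = ⊤) := by
    intro i
    induction i with
    | zero => exact fun _ => Iff.rfl
    | succ i ih => exact fun hi => (ih (by omega)).trans (hadj i hi)
  exact confRank_eq_of_componentSpan_eq_top fun i => (hzero i i.2).1
    ((hzero k hk).2 (componentSpan_eq_top_of_corner P hcor))

end
end
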